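/- Let B_3'(1,1,0,n−4) and B_3^1(1,1,0,n−4) be the graphs obtained from K_4 minus an edge by attaching a pendant path P_{n−4} to a vertex of degree 2, respectively degree 3. Then PS(B_3'(1,1,0,n−4)) − PS(B_3^1(1,1,0,n−4)) = 3·F(n−4) > 0 for n ≥ 5. -/

import Mathlib

open SimpleGraph Finset
open scoped Classical

noncomputable section

namespace PermSum

variable {V W : Type*}

/-- Number of cycle components of the spanning subgraph with edge set `M`:
components all of whose vertices have degree `2`. -/
noncomputable def numCycles [Fintype V] (M : Finset (Sym2 V)) : ℕ :=
  Nat.card {c : (fromEdgeSet (↑M : Set (Sym2 V))).ConnectedComponent //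
    ∀ v, (fromEdgeSet (↑M : Set (Sym2 V))).connectedComponentMk v = c →
      (fromEdgeSet (↑M : Set (Sym2 V))).degree v = 2}

/-- `M` is the edge set of a Sachs subgraph of `G`: each component of the graph it spans is a
single edge or a cycle (every covered vertex has degree 1 or 2, and any vertex of degree 1 has
its neighbours of degree 1). -/
def IsSachs [Fintype V] (G : SimpleGraph V) (M : Finset (Sym2 V)) : Prop :=
  (↑M : Set (Sym2 V)) ⊆ G.edgeSet ∧
  (∀ v ∈ (fromEdgeSet (↑M : Set (Sym2 V))).support,
      (fromEdgeSet (↑M : Set (Sym2 V))).degree v = 1 ∨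
      (fromEdgeSet (↑M : Set (Sym2 V))).degree v = 2) ∧
  (∀ v w, (fromEdgeSet (↑M : Set (Sym2 V))).Adj v w →
      (fromEdgeSet (↑M : Set (Sym2 V))).degree v = 1 →
      (fromEdgeSet (↑M : Set (Sym2 V))).degree w = 1)

/-- The permanental sum of a finite simple graph: `∑_H 2^{c(H)}` over all Sachs subgraphs `H`
(including the empty one). -/
noncomputable def PS [Fintype V] (G : SimpleGraph V) : ℕ :=
  ∑ M ∈ Finset.univ.filter (fun M : Finset (Sym2 V) => IsSachs G M), 2 ^ numCycles M


/-- `B₃(1,1,0)` with a pendant path on `m` further vertices attached to a degree-2 vertex: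
the path `0-1-⋯-(m+3)` together with the chords `{0,2}` and `{1,3}`; the vertices
`0,1,2,3` induce `K₄` minus the edge `{0,3}`, and the path is attached at `3`, a vertex of
degree `2` of the theta graph. -/
def B3deg2 (m : ℕ) : SimpleGraph (Fin (m + 4)) :=
  pathGraph (m + 4) ⊔
    fromEdgeSet {s((0 : Fin (m + 4)), (2 : Fin (m + 4))),
                 s((1 : Fin (m + 4)), (3 : Fin (m + 4)))}

/-- `B₃(1,1,0)` with a pendant path on `m` further vertices attached to a degree-3 vertex:
the path `0-1-⋯-(m+3)` together with the chords `{0,3}` and `{1,3}`; the vertices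
`0,1,2,3` induce `K₄` minus the edge `{0,2}`, and the path is attached at `3`, a vertex of
degree `3` of the theta graph. -/
def B3deg3 (m : ℕ) : SimpleGraph (Fin (m + 4)) :=
  pathGraph (m + 4) ⊔
    fromEdgeSet {s((0 : Fin (m + 4)), (3 : Fin (m + 4))),
                 s((1 : Fin (m + 4)), (3 : Fin (m + 4)))}

/-- Vertex sets of the components of `A` all of whose vertices have exactly two neighbours. -/
def cycleSets (A : SimpleGraph V) : Set (Set V) :=
  {S | ∃ v, S = {w | A.Reachable v w} ∧ ∀ w ∈ S, (A.neighborSet w).ncard = 2}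

/-- Every component of `A` is an isolated vertex, a single edge or a cycle. -/
def IsSachsGraph (A : SimpleGraph V) : Prop :=
  ∀ v w, A.Adj v w → ((A.neighborSet v).ncard = 1 ∨ (A.neighborSet v).ncard = 2) ∧
    ((A.neighborSet v).ncard = 1 → (A.neighborSet w).ncard = 1)

/-- The contribution of the spanning subgraph `A` to the permanental sum. -/
def weight (A : SimpleGraph V) : ℕ :=
  if IsSachsGraph A then 2 ^ (cycleSets A).ncard else 0

theorem degree_eq_ncard [Fintype V] (A : SimpleGraph V) (v : V) [Fintype (A.neighborSet v)] :
    A.degree v = (A.neighborSet v).ncard := by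
  rw [← card_neighborSet_eq_degree, Set.ncard_eq_toFinset_card', Set.toFinset_card]

theorem numCycles_eq_ncard [Fintype V] (M : Finset (Sym2 V)) :
    numCycles M = (cycleSets (fromEdgeSet (M : Set (Sym2 V)))).ncard := by
  rw [numCycles, ← Nat.card_coe_set_eq]
  simp only [degree_eq_ncard]
  refine Nat.card_congr (Equiv.ofBijective (fun c => ⟨c.1.supp, ?_⟩) ⟨?_, ?_⟩)
  · obtain ⟨c, hc⟩ := c
    induction c using ConnectedComponent.ind with
    | _ v =>
      refine ⟨v, ?_, fun w hw => hc w hw⟩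
      ext w
      simp [reachable_comm]
  · rintro ⟨c, hc⟩ ⟨d, hd⟩ h
    exact Subtype.ext (ConnectedComponent.supp_injective (congrArg Subtype.val h))
  · rintro ⟨S, v, rfl, hS⟩
    refine ⟨⟨connectedComponentMk _ v, fun w hw => hS w ?_⟩, ?_⟩
    · exact (ConnectedComponent.eq.1 hw).symm
    · ext w
      simp [reachable_comm]

theorem isSachs_iff [Fintype V] (G : SimpleGraph V) (M : Finset (Sym2 V)) :
    IsSachs G M ↔ (M : Set (Sym2 V)) ⊆ G.edgeSet ∧
      IsSachsGraph (fromEdgeSet (M : Set (Sym2 V))) := by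
  simp only [IsSachs, IsSachsGraph, degree_eq_ncard, mem_support]
  grind

theorem PS_eq_sum_weight [Fintype V] (G : SimpleGraph V) :
    PS G = ∑ A : SimpleGraph V with A ≤ G, weight A := by
  simp only [PS, isSachs_iff, weight, ← Finset.sum_filter, Finset.filter_filter]
  refine Finset.sum_bij' (fun M _ => fromEdgeSet (M : Set (Sym2 V))) (fun A _ => A.edgeFinset)
    ?_ ?_ ?_ ?_ ?_
  · intro M hM
    simp only [Finset.mem_filter, Finset.mem_univ, true_and] at hM ⊢
    exact ⟨fun x y h => hM.1 ((fromEdgeSet_adj _).1 h).1, hM.2⟩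
  · intro A hA
    simp only [Finset.mem_filter, Finset.mem_univ, true_and, coe_edgeFinset, fromEdgeSet_edgeSet,
      edgeSet_subset_edgeSet] at hA ⊢
    exact hA
  · intro M hM
    simp only [Finset.mem_filter, Finset.mem_univ, true_and] at hM
    ext e
    simp only [mem_edgeFinset, edgeSet_fromEdgeSet]
    exact ⟨fun h => h.1, fun h => ⟨h, G.not_isDiag_of_mem_edgeSet (hM.1 h)⟩⟩
  · intro A hA
    simp
  · intro M hM
    rw [numCycles_eq_ncard]

theorem weight_comap (e : V ≃ W) (A : SimpleGraph W) : weight (A.comap e) = weight A := by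
  let f : A.comap e ≃g A := Iso.comap e A
  have hn (v : V) : ((A.comap e).neighborSet v).ncard = (A.neighborSet (e v)).ncard :=
    Set.ncard_congr' (f.mapNeighborSet v)
  have hS : IsSachsGraph (A.comap e) ↔ IsSachsGraph A := by
    simp only [IsSachsGraph, hn, comap_adj, e.forall_congr_left, Equiv.apply_symm_apply]
  have hc : (cycleSets (A.comap e)).ncard = (cycleSets A).ncard := by
    refine Set.ncard_congr' ((Equiv.Set.congr e).subtypeEquiv fun S => e.exists_congr fun v => ?_)
    refine and_congr ?_ ?_
    · rw [Set.ext_iff, Set.ext_iff]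
      refine e.forall_congr fun w => ?_
      have hr : A.Reachable (e v) (e w) ↔ (A.comap e).Reachable v w := f.reachable_iff
      simpa using hr.symm
    · refine e.forall_congr fun w => ?_
      simp [hn]
  rw [weight, weight, hc]
  simp only [hS]

theorem PS_congr_iso [Fintype V] [Fintype W] {G : SimpleGraph V} {H : SimpleGraph W}
    (e : G ≃g H) : PS G = PS H := by
  simp only [PS_eq_sum_weight]
  refine (Finset.sum_bij' (fun A _ => A.comap e) (fun A _ => A.comap e.symm) ?_ ?_ ?_ ?_ ?_).symm
  · intro A hA
    simp only [Finset.mem_filter, Finset.mem_univ, true_and] at hA ⊢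
    exact fun x y h => e.map_adj_iff.1 (hA h)
  · intro A hA
    simp only [Finset.mem_filter, Finset.mem_univ, true_and] at hA ⊢
    exact fun x y h => e.symm.map_adj_iff.1 (hA h)
  · intro A hA
    ext; simp
  · intro A hA
    ext; simp
  · intro A hA
    exact (weight_comap e.toEquiv A).symm

theorem PS_eq_add [Fintype V] {G H : SimpleGraph V} {u v : V}
    (hH : ∀ x y, H.Adj x y ↔ G.Adj x y ∧ s(x, y) ≠ s(u, v)) :
    PS G = PS H + ∑ A : SimpleGraph V with A ≤ G ∧ A.Adj u v, weight A := by
  rw [PS_eq_sum_weight, PS_eq_sum_weight,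
    ← Finset.sum_filter_not_add_sum_filter _ (fun A => A.Adj u v), Finset.filter_filter,
    Finset.filter_filter]
  congr 2
  ext A
  simp only [Finset.mem_filter, Finset.mem_univ, true_and]
  constructor
  · rintro ⟨h, hA⟩ x y hxy
    refine (hH x y).2 ⟨h hxy, fun he => hA ?_⟩
    rwa [← mem_edgeSet, ← he]
  · intro h
    exact ⟨fun x y hxy => ((hH x y).1 (h hxy)).1, fun hA => ((hH u v).1 (h hA)).2 rfl⟩

theorem weight_bot : weight (⊥ : SimpleGraph V) = 1 := by
  have h : cycleSets (⊥ : SimpleGraph V) = ∅ := by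
    rw [Set.eq_empty_iff_forall_notMem]
    rintro S ⟨v, rfl, hS⟩
    have := hS v (Reachable.refl v)
    simp at this
  simp [weight, IsSachsGraph, h]

theorem weight_sup_edge {A : SimpleGraph V} {u v : V} (huv : u ≠ v)
    (hu : ∀ w, ¬ A.Adj u w) (hv : ∀ w, ¬ A.Adj v w) : weight (A ⊔ edge u v) = weight A := by
  have hadj (x y : V) (hxu : x ≠ u) (hxv : x ≠ v) : (A ⊔ edge u v).Adj x y ↔ A.Adj x y := by
    simp [sup_adj, edge_adj]; grind
  have hnu : (A ⊔ edge u v).neighborSet u = {v} := by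
    ext y; simp [edge_adj, hu]; grind
  have hnv : (A ⊔ edge u v).neighborSet v = {u} := by
    ext y; simp [edge_adj, hv]; grind
  have hnu' : A.neighborSet u = ∅ := by
    ext y; simp [hu]
  have hnv' : A.neighborSet v = ∅ := by
    ext y; simp [hv]
  have hn (x : V) (hxu : x ≠ u) (hxv : x ≠ v) :
      (A ⊔ edge u v).neighborSet x = A.neighborSet x := by
    ext y; exact hadj x y hxu hxv
  have hS : IsSachsGraph (A ⊔ edge u v) ↔ IsSachsGraph A := by
    constructor
    · intro h x y hxy
      have := h x y (Or.inl hxy)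
      rwa [hn x, hn y] at this <;> grind [A.adj_comm]
    · intro h x y hxy
      by_cases hx : x = u ∨ x = v
      · have hy : y = u ∨ y = v := by
          simp [sup_adj, edge_adj] at hxy; grind
        have h1 : ((A ⊔ edge u v).neighborSet x).ncard = 1 := by
          rcases hx with rfl | rfl <;> simp [hnu, hnv]
        have h2 : ((A ⊔ edge u v).neighborSet y).ncard = 1 := by
          rcases hy with rfl | rfl <;> simp [hnu, hnv]
        exact ⟨Or.inl h1, fun _ => h2⟩
      · push Not at hx
        have hA := (hadj x y hx.1 hx.2).1 hxy
        rw [hn x hx.1 hx.2, hn y (by grind [A.adj_comm]) (by grind [A.adj_comm])]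
        exact h x y hA
  have hr (x : V) (hxu : x ≠ u) (hxv : x ≠ v) (y : V) :
      (A ⊔ edge u v).Reachable x y ↔ A.Reachable x y := by
    refine ⟨fun ⟨p⟩ => ?_, fun h => h.mono le_sup_left⟩
    induction p with
    | nil => exact Reachable.refl _
    | cons h p ih =>
      have hA := (hadj _ _ hxu hxv).1 h
      exact hA.reachable.trans (ih (by grind [A.adj_comm]) (by grind [A.adj_comm]) ⟨p⟩)
  have hne (x : V) (hxu : x ≠ u) (hxv : x ≠ v) (y : V) (h : A.Reachable x y) : y ≠ u ∧ y ≠ v := by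
    obtain ⟨p⟩ := h
    induction p with
    | nil => exact ⟨hxu, hxv⟩
    | cons h p ih => exact ih (by grind [A.adj_comm]) (by grind [A.adj_comm])
  have hc : cycleSets (A ⊔ edge u v) = cycleSets A := by
    ext S
    refine exists_congr fun x => ?_
    by_cases hxu : x = u
    · subst hxu
      constructor <;> rintro ⟨rfl, h⟩ <;> have := h x (Reachable.refl x) <;> simp_all
    by_cases hxv : x = v
    · subst hxv
      constructor <;> rintro ⟨rfl, h⟩ <;> have := h x (Reachable.refl x) <;> simp_all
    simp only [hr x hxu hxv]
    refine and_congr_right ?_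
    rintro rfl
    refine forall₂_congr fun y hy => ?_
    rw [hn y (hne x hxu hxv y hy).1 (hne x hxu hxv y hy).2]
  simp only [weight, hS, hc]

/-- A graph in which a vertex with a single neighbour is adjacent to a vertex with two distinct
neighbours has weight zero. -/
theorem weight_eq_zero {A : SimpleGraph V} {u v w : V} (huv : A.Adj u v)
    (huw : A.Adj u w) (hvw : v ≠ w) (hv : ∀ x, A.Adj v x → x = u) : weight A = 0 := by
  refine if_neg fun h => ?_
  have h1 : A.neighborSet v = {u} := by
    ext x
    exact ⟨hv x, by rintro rfl; exact huv.symm⟩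
  have h2 := (h v u huv.symm).2 (by simp [h1])
  obtain ⟨x, hx⟩ := Set.ncard_eq_one.1 h2
  have hvx : v ∈ A.neighborSet u := huv
  have hwx : w ∈ A.neighborSet u := huw
  rw [hx] at hvx hwx
  exact hvw (hvx.trans hwx.symm)

theorem PS_pendant [Fintype V] {G H K : SimpleGraph V} {u v : V} (huv : G.Adj u v)
    (hv : ∀ w, G.Adj v w → w = u) (hH : ∀ x y, H.Adj x y ↔ G.Adj x y ∧ s(x, y) ≠ s(u, v))
    (hK : ∀ x y, K.Adj x y ↔ G.Adj x y ∧ (x ≠ u ∧ x ≠ v) ∧ y ≠ u ∧ y ≠ v) :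
    PS G = PS H + PS K := by
  have hKu (A : SimpleGraph V) (hA : A ≤ K) (w : V) : ¬ A.Adj u w := fun h => by
    have := (hK _ _).1 (hA h); simp at this
  have hKv (A : SimpleGraph V) (hA : A ≤ K) (w : V) : ¬ A.Adj v w := fun h => by
    have := (hK _ _).1 (hA h); simp at this
  rw [PS_eq_add hH, PS_eq_sum_weight K]
  congr 1
  symm
  refine Finset.sum_of_injOn (fun A => A ⊔ edge u v) ?_ ?_ ?_ ?_
  · intro A hA B hB hAB
    simp only [Finset.coe_filter, Finset.mem_univ, true_and, Set.mem_ofPred_eq] at hA hB hAB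
    ext x y
    have h := congrArg (fun C => C.Adj x y) hAB
    simp only [sup_adj, edge_adj] at h
    have := hKu A hA
    have := hKu B hB
    have := hKv A hA
    have := hKv B hB
    grind
  · intro A hA
    simp only [Finset.coe_filter, Finset.mem_univ, true_and, Set.mem_ofPred_eq] at hA ⊢
    refine ⟨sup_le (fun x y h => ((hK x y).1 (hA h)).1) ?_, Or.inr ?_⟩
    · rw [edge_le_iff]; exact Or.inr huv
    · simp [edge_adj, huv.ne]
  · intro A hA hA'
    simp only [Finset.mem_filter, Finset.mem_univ, true_and] at hA
    by_contra hw
    have hAv (x : V) (h : A.Adj v x) : x = u := hv x (hA.1 h)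
    have hAu (x : V) (h : A.Adj u x) : x = v := by
      by_contra hx
      exact hw (weight_eq_zero hA.2 h (Ne.symm hx) hAv)
    refine hA' ⟨A.deleteEdges {s(u, v)}, ?_, ?_⟩
    · simp only [Finset.coe_filter, Finset.mem_univ, true_and, Set.mem_ofPred_eq]
      intro x y h
      simp only [deleteEdges_adj, Set.mem_singleton_iff] at h
      have := hA.1 h.1
      rw [hK]
      grind [A.adj_comm]
    · ext x y
      have := hA.2
      simp only [sup_adj, edge_adj, deleteEdges_adj, Set.mem_singleton_iff]
      grind [A.adj_comm, A.ne_of_adj]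
  · intro A hA
    simp only [Finset.mem_filter, Finset.mem_univ, true_and] at hA
    exact (weight_sup_edge huv.ne (hKu A hA) (hKv A hA)).symm

theorem weight_triangle {T : SimpleGraph V} {a b c : V} (hab : a ≠ b) (hac : a ≠ c) (hbc : b ≠ c)
    (hT : ∀ x y, T.Adj x y ↔ x ≠ y ∧ (x = a ∨ x = b ∨ x = c) ∧ (y = a ∨ y = b ∨ y = c)) :
    weight T = 2 := by
  have hn (x : V) (hx : x = a ∨ x = b ∨ x = c) : (T.neighborSet x).ncard = 2 := by
    rw [Set.ncard_eq_two]
    simp only [Set.ext_iff, mem_neighborSet, hT, Set.mem_insert_iff, Set.mem_singleton_iff]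
    rcases hx with rfl | rfl | rfl
    · exact ⟨b, c, hbc, by grind⟩
    · exact ⟨a, c, hac, by grind⟩
    · exact ⟨a, b, hab, by grind⟩
  have hS : IsSachsGraph T := fun x y h => by
    simp [hn x ((hT x y).1 h).2.1]
  have hr (x y : V) (hx : x = a ∨ x = b ∨ x = c) :
      T.Reachable x y ↔ y = a ∨ y = b ∨ y = c := by
    constructor
    · rintro ⟨p⟩
      induction p with
      | nil => exact hx
      | cons h p ih => exact ih ((hT _ _).1 h).2.2
    · intro hy
      by_cases h : x = y
      · rw [h]
      · exact ((hT x y).2 ⟨h, hx, hy⟩).reachable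
  have hc : cycleSets T = {{a, b, c}} := by
    ext S
    rw [Set.mem_singleton_iff]
    constructor
    · rintro ⟨x, rfl, h⟩
      have hx : x = a ∨ x = b ∨ x = c := by
        by_contra hx
        have h0 : T.neighborSet x = ∅ := by
          ext y; simp [hT, hx]
        have := h x (Reachable.refl x)
        simp [h0] at this
      ext y
      simp [hr x y hx]
    · rintro rfl
      refine ⟨a, ?_, fun x hx => hn x (by simpa using hx)⟩
      ext y
      simp [hr a y (Or.inl rfl)]
  simp [weight, hS, hc]

theorem PS_triangle [Fintype V] {T P : SimpleGraph V} {a b c : V} (hab : a ≠ b) (hac : a ≠ c)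
    (hbc : b ≠ c)
    (hT : ∀ x y, T.Adj x y ↔ x ≠ y ∧ (x = a ∨ x = b ∨ x = c) ∧ (y = a ∨ y = b ∨ y = c))
    (hP : ∀ x y, P.Adj x y ↔ T.Adj x y ∧ s(x, y) ≠ s(a, c)) : PS T = PS P + 3 := by
  rw [PS_eq_add hP]
  congr 1
  have hne : edge a c ≠ T := fun h => by
    have h1 : T.Adj a b := (hT a b).2 (by grind)
    rw [← h, edge_adj] at h1
    grind
  have he : weight (edge a c) = 1 := by
    rw [← bot_sup_eq (edge a c), weight_sup_edge hac (by simp) (by simp), weight_bot]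
  rw [← Finset.sum_subset (s₁ := {edge a c, T}), Finset.sum_pair hne, he,
    weight_triangle hab hac hbc hT]
  · intro A hA
    simp only [Finset.mem_insert, Finset.mem_singleton] at hA
    simp only [Finset.mem_filter, Finset.mem_univ, true_and]
    have hTac : T.Adj a c := (hT a c).2 (by grind)
    rcases hA with rfl | rfl
    · exact ⟨(edge_le_iff T).2 (Or.inr hTac), by simp [edge_adj, hac]⟩
    · exact ⟨le_rfl, hTac⟩
  · intro A hA hA'
    simp only [Finset.mem_insert, Finset.mem_singleton, not_or, Finset.mem_filter,
      Finset.mem_univ, true_and] at hA hA'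
    have hle (x y : V) (h : A.Adj x y) := (hT x y).1 (hA.1 h)
    have hadj := hA.2
    by_cases h1 : A.Adj a b <;> by_cases h2 : A.Adj b c
    · refine absurd ?_ hA'.2
      ext x y
      rw [hT]
      refine ⟨hle x y, ?_⟩
      grind [A.adj_comm]
    · exact weight_eq_zero hadj h1 hbc.symm (by grind [A.adj_comm])
    · exact weight_eq_zero hadj.symm h2.symm hab (by grind [A.adj_comm])
    · refine absurd ?_ hA'.1
      ext x y
      rw [edge_adj]
      grind [A.adj_comm]

/-- The edges of `G` between vertices smaller than `k`. -/
def below {N : ℕ} (G : SimpleGraph (Fin N)) (k : ℕ) : SimpleGraph (Fin N) where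
  Adj x y := G.Adj x y ∧ x.1 < k ∧ y.1 < k
  symm := ⟨fun _ _ h => ⟨h.1.symm, h.2.2, h.2.1⟩⟩
  loopless := ⟨fun _ h => h.1.ne rfl⟩

theorem PS_below_add_two {N k : ℕ} {G : SimpleGraph (Fin N)} (hk : k + 1 < N)
    (hG : ∀ x : Fin N, x.1 < k + 1 → (G.Adj ⟨k + 1, hk⟩ x ↔ x.1 = k)) :
    PS (below G (k + 2)) = PS (below G (k + 1)) + PS (below G k) := by
  apply PS_pendant (u := ⟨k, by omega⟩) (v := ⟨k + 1, hk⟩)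
  · exact ⟨((hG _ (by simp)).2 rfl).symm, by simp, by simp⟩
  · rintro w ⟨h, -, h2⟩
    have hne := h.ne
    simp only [ne_eq, Fin.ext_iff] at hne ⊢
    exact (hG w (by omega)).1 h
  · intro x y
    simp only [below, ne_eq, Sym2.eq_iff, Fin.ext_iff]
    constructor
    · rintro ⟨h, h1, h2⟩
      exact ⟨⟨h, by omega, by omega⟩, by omega⟩
    · rintro ⟨⟨h, h1, h2⟩, h3⟩
      have hne := h.ne
      have hx : y.1 = k + 1 → x.1 = k := fun hy => by
        obtain rfl : y = ⟨k + 1, hk⟩ := Fin.ext hy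
        simp only [ne_eq, Fin.ext_iff] at hne
        exact (hG x (by omega)).1 h.symm
      have hy : x.1 = k + 1 → y.1 = k := fun hx => by
        obtain rfl : x = ⟨k + 1, hk⟩ := Fin.ext hx
        simp only [ne_eq, Fin.ext_iff] at hne
        exact (hG y (by omega)).1 h
      exact ⟨h, by omega, by omega⟩
  · intro x y
    simp only [below, ne_eq, Fin.ext_iff]
    constructor
    · rintro ⟨h, h1, h2⟩
      exact ⟨⟨h, by omega, by omega⟩, by omega, by omega⟩
    · rintro ⟨⟨h, h1, h2⟩, h3, h4⟩
      exact ⟨h, by omega, by omega⟩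

theorem B3deg2_adj (m : ℕ) (x y : Fin (m + 4)) : (B3deg2 m).Adj x y ↔
    x.1 + 1 = y.1 ∨ y.1 + 1 = x.1 ∨ (x.1 = 0 ∧ y.1 = 2) ∨ (x.1 = 2 ∧ y.1 = 0) ∨
      (x.1 = 1 ∧ y.1 = 3) ∨ (x.1 = 3 ∧ y.1 = 1) := by
  have h0 : ((0 : Fin (m + 4)) : ℕ) = 0 := rfl
  have h1 : ((1 : Fin (m + 4)) : ℕ) = 1 := rfl
  have h2 : ((2 : Fin (m + 4)) : ℕ) = 2 := rfl
  have h3 : ((3 : Fin (m + 4)) : ℕ) = 3 := rfl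
  simp only [B3deg2, sup_adj, pathGraph_adj, fromEdgeSet_adj, Set.mem_insert_iff,
    Set.mem_singleton_iff, Sym2.eq_iff, Fin.ext_iff, ne_eq, h0, h1, h2, h3]
  omega

theorem B3deg3_adj (m : ℕ) (x y : Fin (m + 4)) : (B3deg3 m).Adj x y ↔
    x.1 + 1 = y.1 ∨ y.1 + 1 = x.1 ∨ (x.1 = 0 ∧ y.1 = 3) ∨ (x.1 = 3 ∧ y.1 = 0) ∨
      (x.1 = 1 ∧ y.1 = 3) ∨ (x.1 = 3 ∧ y.1 = 1) := by
  have h0 : ((0 : Fin (m + 4)) : ℕ) = 0 := rfl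
  have h1 : ((1 : Fin (m + 4)) : ℕ) = 1 := rfl
  have h3 : ((3 : Fin (m + 4)) : ℕ) = 3 := rfl
  simp only [B3deg3, sup_adj, pathGraph_adj, fromEdgeSet_adj, Set.mem_insert_iff,
    Set.mem_singleton_iff, Sym2.eq_iff, Fin.ext_iff, ne_eq, h0, h1, h3]
  omega

theorem PS_below_three (m : ℕ) :
    PS (below (B3deg2 m) 3) = PS (below (B3deg3 m) 3) + 3 := by
  apply PS_triangle (a := ⟨0, by omega⟩) (b := ⟨1, by omega⟩) (c := ⟨2, by omega⟩)
  · simp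
  · simp
  · simp
  · intro x y
    simp only [below, B3deg2_adj, Fin.ext_iff, ne_eq]
    omega
  · intro x y
    simp only [below, B3deg2_adj, B3deg3_adj, Fin.ext_iff, ne_eq, Sym2.eq_iff]
    omega

theorem PS_below_four (m : ℕ) :
    PS (below (B3deg2 m) 4) = PS (below (B3deg3 m) 4) := by
  refine PS_congr_iso ⟨Equiv.swap ⟨2, by omega⟩ ⟨3, by omega⟩, ?_⟩
  intro x y
  simp only [below, B3deg2_adj, B3deg3_adj, Equiv.swap_apply_def, Fin.ext_iff]
  split_ifs <;> simp [-Fin.val_eq_zero_iff] <;> omega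

theorem PS_below_add_four (m k : ℕ) (hk : k ≤ m) :
    PS (below (B3deg2 m) (k + 4)) = PS (below (B3deg3 m) (k + 4)) + 3 * Nat.fib k := by
  induction k using Nat.strong_induction_on with
  | _ k ih =>
    have step (j : ℕ) (hj : j + 4 < m + 4) :
        PS (below (B3deg2 m) (j + 5)) = PS (below (B3deg2 m) (j + 4)) +
          PS (below (B3deg2 m) (j + 3)) ∧
        PS (below (B3deg3 m) (j + 5)) = PS (below (B3deg3 m) (j + 4)) +
          PS (below (B3deg3 m) (j + 3)) := by
      constructor <;> refine PS_below_add_two hj fun x hx => ?_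
      · rw [B3deg2_adj]; grind
      · rw [B3deg3_adj]; grind
    match k with
    | 0 => simpa using PS_below_four m
    | 1 =>
      have h := step 0 (by omega)
      have h3 := PS_below_three m
      have h4 := PS_below_four m
      simp only [zero_add] at h
      simp only [Nat.fib_one, Nat.reduceAdd]
      omega
    | j + 2 =>
      have h := step (j + 1) (by omega)
      have h1 := ih j (by omega) (by omega)
      have h2 := ih (j + 1) (by omega) (by omega)
      simp only [add_assoc, Nat.reduceAdd] at h h1 h2 ⊢
      rw [Nat.fib_add_two]
      omega

theorem below_self {N : ℕ} (G : SimpleGraph (Fin N)) : below G N = G := by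
  ext x y
  simp [below]

/-- `PS(B₃'(1,1,0,n-4)) - PS(B₃¹(1,1,0,n-4)) = 3·F(n-4) > 0` for `n ≥ 5`
(here `n = m + 4`, `m ≥ 1`). -/
theorem PS_B3_diff (m : ℕ) (hm : 1 ≤ m) :
    (PS (B3deg2 m) : ℤ) - PS (B3deg3 m) = 3 * Nat.fib m ∧ (0 : ℤ) < 3 * Nat.fib m := by
  have h := PS_below_add_four m m le_rfl
  rw [below_self, below_self] at h
  have hf : 0 < Nat.fib m := Nat.fib_pos.2 hm
  omega

end PermSum
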